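/- arXiv:0907.1793 — 2 statements merged into one kernel-verified Lean document; each statement's English description precedes it below -/
import Mathlib

section
/- Let (L, L̄) be a diametral pair of linear extensions of the Boolean lattice B_n, let D ⊆ [n] with |D| = d ≥ 2, and let I ⊆ [n] \ D. Then the number of unordered pairs {S,T} of subsets of [n] with S △ T = D and S ∩ T = I that appear in different orders in L and L̄ is exactly 2^{d−2}. -/
open Finset
open scoped symmDiff

/-- `L` is a linear extension of the partial order on `α`. -/
def IsLinExt {α : Type*} [PartialOrder α] (L : α → α → Prop) : Prop :=
  IsLinearOrder α L ∧ ∀ x y : α, x ≤ y → L x y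

/-- The number of unordered pairs of elements appearing in different orders in `L₁` and `L₂`,
counted via the ordered pairs that are strictly below in `L₁` and strictly above in `L₂`. -/
noncomputable def revCount {α : Type*} (L₁ L₂ : α → α → Prop) : ℕ :=
  Set.ncard {p : α × α | p.1 ≠ p.2 ∧ L₁ p.1 p.2 ∧ L₂ p.2 p.1}

/-- The strict σ-revlex order on subsets of `[n]`: `S < T` iff the σ-largest element of the
symmetric difference `S ∆ T` belongs to `T`. -/
def SigmaRevLexLT {n : ℕ} (σ : Equiv.Perm (Fin n)) (S T : Finset (Fin n)) : Prop :=
  ∃ m ∈ T \ S, ∀ x ∈ S ∆ T, σ.symm x ≤ σ.symm m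

/-- The σ-revlex linear extension `L_σ` of the Boolean lattice, as a reflexive relation. -/
def SigmaRevLex {n : ℕ} (σ : Equiv.Perm (Fin n)) (S T : Finset (Fin n)) : Prop :=
  S = T ∨ SigmaRevLexLT σ S T

/-- The reverse `σ̄` of a permutation `σ` of `[n]`. -/
def revPermOf {n : ℕ} (σ : Equiv.Perm (Fin n)) : Equiv.Perm (Fin n) :=
  (Fin.revPerm : Equiv.Perm (Fin n)).trans σ

/-- An ordered pair `(x,y)` of a poset is a critical pair. -/
def IsCriticalPair {α : Type*} [PartialOrder α] (x y : α) : Prop :=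
  ¬ x ≤ y ∧ ¬ y ≤ x ∧ (∀ z, z < x → z < y) ∧ (∀ z, y < z → x < z)

/-- The downsets of a finite poset, as a poset ordered by inclusion. -/
abbrev DownFinset (α : Type*) [PartialOrder α] : Type _ :=
  {S : Finset α // IsLowerSet (↑S : Set α)}

/-- The strict σ-revlex order on downsets of a poset, for a linear extension `σ`. -/
def DRevLexLT {α : Type*} [PartialOrder α] [DecidableEq α] (σ : α → α → Prop)
    (S T : DownFinset α) : Prop :=
  ∃ m ∈ T.1 \ S.1, ∀ x ∈ S.1 ∆ T.1, σ x m

/-- The σ-revlex linear extension `L_σ` of the downset lattice, as a reflexive relation. -/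
def DRevLex {α : Type*} [PartialOrder α] [DecidableEq α] (σ : α → α → Prop)
    (S T : DownFinset α) : Prop :=
  S = T ∨ DRevLexLT σ S T

/-- The comparability graph of the subposet induced on `D`. -/
def compGraph {α : Type*} [PartialOrder α] (D : Set α) : SimpleGraph D :=
  SimpleGraph.fromRel fun x y => (x : α) ≤ (y : α)

/-- The number of connected components of the subposet induced on `D`. -/
noncomputable def numComponents {α : Type*} [PartialOrder α] (D : Set α) : ℕ :=
  Nat.card (compGraph D).ConnectedComponent

/-- `{σ, τ}` is a realizer of cardinality 2 of the partial order on `α`. -/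
def IsRealizer2 {α : Type*} [PartialOrder α] (σ τ : α → α → Prop) : Prop :=
  IsLinExt σ ∧ IsLinExt τ ∧ ∀ x y : α, x ≤ y ↔ σ x y ∧ τ x y

/-- A linear extension `π` is non-separating. -/
def NonSeparating {α : Type*} [PartialOrder α] (π : α → α → Prop) : Prop :=
  ¬ ∃ u v x : α, u < v ∧ ¬ x ≤ u ∧ ¬ u ≤ x ∧ ¬ x ≤ v ∧ ¬ v ≤ x ∧
      π u x ∧ u ≠ x ∧ π x v ∧ x ≠ v

/-- The principal downset of an element. -/
def pdown {α : Type*} [Fintype α] [PartialOrder α] [DecidableEq α]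
    [DecidableRel ((· ≤ ·) : α → α → Prop)] (x : α) : DownFinset α :=
  ⟨Finset.univ.filter (· ≤ x), by
    intro a b hba ha
    simp only [Finset.mem_coe, Finset.mem_filter] at ha ⊢
    exact ⟨Finset.mem_univ b, hba.trans ha.2⟩⟩

/-- Pulling back a linear order along an injective monotone map gives a linear extension. -/
theorem isLinExt_of_injective_of_monotone {α β : Type*} [PartialOrder α] [LinearOrder β]
    {f : α → β} (hinj : Function.Injective f) (hmono : Monotone f) :
    IsLinExt fun x y => f x ≤ f y :=
  ⟨{ refl := fun _ => le_rfl
     trans := fun _ _ _ => le_trans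
     antisymm := fun _ _ h₁ h₂ => hinj (le_antisymm h₁ h₂)
     total := fun _ _ => le_total _ _ }, fun _ _ h => hmono h⟩

section Classes

variable {α : Type*} [DecidableEq α]

/-- The reversals between `L₁` and `L₂` of pairs with symmetric difference `D` and
intersection `I`. -/
def classReversals (L₁ L₂ : Finset α → Finset α → Prop) (D I : Finset α) :
    Set (Finset α × Finset α) :=
  {p | p.1 ∆ p.2 = D ∧ p.1 ∩ p.2 = I ∧ L₁ p.1 p.2 ∧ L₂ p.2 p.1}

open Classical in
/-- The subsets `A` of `D` for which `I ∪ A` precedes `I ∪ (D \ A)`. -/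
noncomputable def precedingSubsets (L : Finset α → Finset α → Prop) (D I : Finset α) :
    Finset (Finset α) :=
  {A ∈ D.powerset | L (I ∪ A) (I ∪ (D \ A))}

theorem mem_precedingSubsets {L : Finset α → Finset α → Prop} {D I A : Finset α} :
    A ∈ precedingSubsets L D I ↔ A ⊆ D ∧ L (I ∪ A) (I ∪ (D \ A)) := by
  simp [precedingSubsets]

theorem isLowerSet_precedingSubsets {L : Finset α → Finset α → Prop} (hL : IsLinExt L)
    (D I : Finset α) : IsLowerSet (precedingSubsets L D I : Set (Finset α)) := by
  intro A B hBA hA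
  have := hL.1
  rw [mem_coe, mem_precedingSubsets] at hA ⊢
  have hBA : B ⊆ A := hBA
  exact ⟨hBA.trans hA.1, trans_of L (hL.2 _ _ (union_subset_union_right hBA))
    (trans_of L hA.2 (hL.2 _ _ (union_subset_union_right (sdiff_subset_sdiff le_rfl hBA))))⟩

theorem union_ne_union_sdiff {D I : Finset α} (hD : D.Nonempty) (hDI : Disjoint D I)
    (A : Finset α) : I ∪ A ≠ I ∪ (D \ A) := by
  obtain ⟨x, hx⟩ := hD
  intro h
  have hxI : x ∉ I := disjoint_left.1 hDI hx
  have := Finset.ext_iff.1 h x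
  simp only [mem_union, mem_sdiff, hxI, hx, false_or, true_and] at this
  tauto

theorem two_mul_card_precedingSubsets {L : Finset α → Finset α → Prop} (hL : IsLinExt L)
    {D I : Finset α} (hD : D.Nonempty) (hDI : Disjoint D I) :
    2 * #(precedingSubsets L D I) = 2 ^ #D := by
  classical
  have := hL.1
  have hcompl : #(precedingSubsets L D I) =
      #{A ∈ D.powerset | ¬ L (I ∪ A) (I ∪ (D \ A))} := by
    refine card_nbij' (D \ ·) (D \ ·) ?_ ?_ ?_ ?_
    · intro A hA
      rw [mem_coe, mem_precedingSubsets] at hA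
      simp only [coe_filter, mem_powerset, Set.mem_ofPred_eq, sdiff_subset, true_and,
        Finset.sdiff_sdiff_eq_self hA.1]
      exact fun h => union_ne_union_sdiff hD hDI A (antisymm_of L hA.2 h)
    · intro A hA
      simp only [coe_filter, mem_powerset, Set.mem_ofPred_eq] at hA
      rw [mem_coe, mem_precedingSubsets]
      simp only [sdiff_subset, true_and, Finset.sdiff_sdiff_eq_self hA.1]
      exact (total_of L _ _).resolve_left hA.2
    · intro A hA
      exact Finset.sdiff_sdiff_eq_self (mem_precedingSubsets.1 hA).1
    · intro A hA
      exact Finset.sdiff_sdiff_eq_self (mem_powerset.1 (mem_filter.1 hA).1)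
  rw [two_mul]
  nth_rewrite 2 [hcompl]
  rw [← card_powerset, precedingSubsets]
  exact card_filter_add_card_filter_not _

theorem ncard_classReversals_le {L₁ L₂ : Finset α → Finset α → Prop} (h₁ : IsLinExt L₁)
    (h₂ : IsLinExt L₂) {D I : Finset α} (hd : 2 ≤ #D) (hDI : Disjoint D I) :
    (classReversals L₁ L₂ D I).ncard ≤ 2 ^ (#D - 2) := by
  have hD : D.Nonempty := card_pos.1 (by lia)
  have := h₂.1
  set 𝒜 := precedingSubsets L₁ D I with h𝒜
  set ℬ := precedingSubsets L₂ D I with hℬ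
  have hsub : classReversals L₁ L₂ D I ⊆
      (fun A => (I ∪ A, I ∪ (D \ A))) '' (↑(𝒜 \ ℬ) : Set (Finset α)) := by
    rintro ⟨S, T⟩ ⟨hST, hI, hS, hT⟩
    dsimp only at hST hI hS hT
    have e₁ : I ∪ S \ T = S := by rw [← hI]; ext x; simp; tauto
    have e₂ : I ∪ (D \ (S \ T)) = T := by
      rw [← hI, ← hST]; ext x; simp [mem_symmDiff]; tauto
    refine ⟨S \ T, ?_, by simp only [e₁, e₂]⟩
    rw [mem_coe, mem_sdiff, h𝒜, hℬ, mem_precedingSubsets, mem_precedingSubsets, e₁, e₂]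
    refine ⟨⟨?_, hS⟩, fun h => ?_⟩
    · rw [← hST]; exact subset_union_left
    · have hne := union_ne_union_sdiff hD hDI (S \ T)
      rw [e₁, e₂] at hne
      exact hne (antisymm_of L₂ h.2 hT)
  have hle : (classReversals L₁ L₂ D I).ncard ≤ #(𝒜 \ ℬ) :=
    (Set.ncard_le_ncard hsub (Set.toFinite _)).trans
      ((Set.ncard_image_le (Set.toFinite _)).trans (Set.ncard_coe_finset _).le)
  have hk := (isLowerSet_precedingSubsets h₁ D I).le_card_inter_finset'
    (isLowerSet_precedingSubsets h₂ D I) (fun _ h => (mem_precedingSubsets.1 h).1)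
    (fun _ h => (mem_precedingSubsets.1 h).1)
  have c₁ := two_mul_card_precedingSubsets h₁ hD hDI
  have c₂ := two_mul_card_precedingSubsets h₂ hD hDI
  rw [← h𝒜, ← hℬ] at hk
  rw [← h𝒜] at c₁
  rw [← hℬ] at c₂
  obtain ⟨e, he⟩ := Nat.exists_eq_add_of_le' hd
  rw [he] at hk c₁ c₂ ⊢
  rw [Nat.add_sub_cancel]
  have hpos : 0 < 2 ^ e := by positivity
  have c₁' : #𝒜 = 2 * 2 ^ e := by rw [pow_add] at c₁; lia
  have c₂' : #ℬ = 2 * 2 ^ e := by rw [pow_add] at c₂; lia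
  have hcap : 2 ^ e ≤ #(𝒜 ∩ ℬ) := by
    rw [c₁', c₂', pow_add] at hk
    nlinarith
  have := card_sdiff_add_card_inter 𝒜 ℬ
  lia

theorem two_le_card_symmDiff_of_reversed {L₁ L₂ : Finset α → Finset α → Prop}
    (h₁ : IsLinExt L₁) (h₂ : IsLinExt L₂) {S T : Finset α} (hne : S ≠ T) (hS : L₁ S T)
    (hT : L₂ T S) : 2 ≤ #(S ∆ T) := by
  have := h₁.1
  have := h₂.1
  have hST : ¬ S ⊆ T := fun h => hne (antisymm_of L₂ (h₂.2 _ _ h) hT)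
  have hTS : ¬ T ⊆ S := fun h => hne (antisymm_of L₁ hS (h₁.2 _ _ h))
  rw [← sdiff_nonempty, ← card_pos] at hST hTS
  have : #(S ∆ T) = #(S \ T) + #(T \ S) := card_union_of_disjoint disjoint_sdiff_sdiff
  lia

theorem revCount_eq_sum_ncard_classReversals [Fintype α] {L₁ L₂ : Finset α → Finset α → Prop}
    (h₁ : IsLinExt L₁) (h₂ : IsLinExt L₂) :
    revCount L₁ L₂ = ∑ k : Finset α × Finset α with 2 ≤ #k.1 ∧ Disjoint k.1 k.2,
      (classReversals L₁ L₂ k.1 k.2).ncard := by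
  classical
  rw [revCount, Set.ncard_eq_toFinset_card',
    card_eq_sum_card_fiberwise (f := fun p : Finset α × Finset α => (p.1 ∆ p.2, p.1 ∩ p.2))
      (t := {k | 2 ≤ #k.1 ∧ Disjoint k.1 k.2})]
  · refine sum_congr rfl fun k hk => ?_
    rw [← Set.ncard_coe_finset]
    congr 1
    ext p
    have hk₂ : 2 ≤ #k.1 := (mem_filter.1 hk).2.1
    simp only [coe_filter, Set.mem_toFinset, Set.mem_ofPred_eq, classReversals, Prod.ext_iff]
    refine ⟨fun h => ⟨h.2.1, h.2.2, h.1.2⟩, fun h => ⟨⟨?_, h.2.2⟩, h.1, h.2.1⟩⟩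
    intro he
    rw [← h.1, he, symmDiff_self] at hk₂
    simp at hk₂
  · intro p hp
    simp only [Set.coe_toFinset, Set.mem_ofPred_eq] at hp
    simp only [coe_filter, mem_univ, true_and, Set.mem_ofPred_eq]
    exact ⟨two_le_card_symmDiff_of_reversed h₁ h₂ hp.1 hp.2.1 hp.2.2,
      disjoint_symmDiff_inf p.1 p.2⟩

/-- A class has at least `2 ^ (#D - 2)` reversals if `L₁` is decided by `b` and `L₂` by `a`. -/
theorem pow_le_ncard_classReversals [Finite α] {L₁ L₂ : Finset α → Finset α → Prop}
    {D I : Finset α} {a b : α} (ha : a ∈ D) (hb : b ∈ D) (hab : a ≠ b) (hDI : Disjoint D I)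
    (h₁ : ∀ S T, S ∆ T = D → b ∈ T → b ∉ S → L₁ S T)
    (h₂ : ∀ S T, S ∆ T = D → a ∈ S → a ∉ T → L₂ T S) :
    2 ^ (#D - 2) ≤ (classReversals L₁ L₂ D I).ncard := by
  have hcard : #((D.erase a).erase b) = #D - 2 := by
    rw [card_erase_of_mem (mem_erase.2 ⟨hab.symm, hb⟩), card_erase_of_mem ha]
    lia
  rw [← hcard, ← card_powerset, ← Set.ncard_coe_finset]
  have hnot : ∀ x, x ∈ D → x ∉ I := fun x hx => disjoint_left.1 hDI hx
  refine Set.ncard_le_ncard_of_injOn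
    (fun B => (I ∪ insert a B, I ∪ (D \ insert a B))) ?_ ?_ (Set.toFinite _)
  · intro B hB
    have hB : ∀ x ∈ B, x ≠ b ∧ x ≠ a ∧ x ∈ D := fun x hx => by
      simpa only [mem_erase] using mem_powerset.1 (mem_coe.1 hB) hx
    have hsd : (I ∪ insert a B) ∆ (I ∪ (D \ insert a B)) = D := by
      ext x
      have := hnot x
      have := hB x
      by_cases hxa : x = a
      · subst hxa
        simp [mem_symmDiff, ha, hnot x ha]
      · simp only [mem_symmDiff, mem_union, mem_insert, mem_sdiff, hxa, false_or]
        tauto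
    refine ⟨hsd, ?_, h₁ _ _ hsd ?_ ?_, h₂ _ _ hsd ?_ ?_⟩
    · ext x
      simp only [mem_inter, mem_union, mem_sdiff]
      tauto
    · have : b ∉ B := fun h => (hB b h).1 rfl
      simp [hb, hab.symm, this]
    · have : b ∉ B := fun h => (hB b h).1 rfl
      simp [hnot b hb, hab.symm, this]
    · simp
    · simp [hnot a ha]
  · intro B hB C hC h
    have hB : ∀ x ∈ B, x ≠ b ∧ x ≠ a ∧ x ∈ D := fun x hx => by
      simpa only [mem_erase] using mem_powerset.1 (mem_coe.1 hB) hx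
    have hC : ∀ x ∈ C, x ≠ b ∧ x ≠ a ∧ x ∈ D := fun x hx => by
      simpa only [mem_erase] using mem_powerset.1 (mem_coe.1 hC) hx
    ext x
    have h := Finset.ext_iff.1 (Prod.ext_iff.1 h).1 x
    simp only [mem_union, mem_insert] at h
    have := hnot x
    have := hB x
    have := hC x
    tauto

end Classes

theorem toColex_le_toColex_of_symmDiff {α : Type*} [LinearOrder α] {S T : Finset α} {m : α}
    (hm : ∀ x ∈ S ∆ T, x ≤ m) (hT : m ∈ T) (hS : m ∉ S) : toColex S ≤ toColex T :=
  Colex.toColex_le_toColex.2 fun x hxS hxT =>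
    ⟨m, hT, hS, hm x (mem_symmDiff.2 (.inl ⟨hxS, hxT⟩))⟩

/-- The colexicographic order and its reversal contribute `2 ^ (#D - 2)` reversals to every
class with `2 ≤ #D`. -/
theorem exists_isLinExt_pow_le_ncard_classReversals (α : Type*) [LinearOrder α] [Finite α] :
    ∃ M₁ M₂ : Finset α → Finset α → Prop, IsLinExt M₁ ∧ IsLinExt M₂ ∧
      ∀ D I : Finset α, 2 ≤ #D → Disjoint D I →
        2 ^ (#D - 2) ≤ (classReversals M₁ M₂ D I).ncard := by
  let e : α ↪ αᵒᵈ := OrderDual.toDual.toEmbedding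
  refine ⟨fun S T => toColex S ≤ toColex T, fun S T => toColex (S.map e) ≤ toColex (T.map e),
    isLinExt_of_injective_of_monotone toColex.injective Colex.toColex_mono,
    isLinExt_of_injective_of_monotone (toColex.injective.comp (map_injective e))
      (Colex.toColex_mono.comp fun _ _ h => map_subset_map.2 h), fun D I hd hDI => ?_⟩
  have hD : 1 < #D := hd
  have hne : D.Nonempty := card_pos.1 (by lia)
  refine pow_le_ncard_classReversals (D.min'_mem hne) (D.max'_mem hne)
    (D.min'_lt_max'_of_card hD).ne hDI ?_ ?_
  · intro S T hST hT hS
    exact toColex_le_toColex_of_symmDiff (fun x hx => D.le_max' x (hST ▸ hx)) hT hS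
  · intro S T hST hS hT
    refine toColex_le_toColex_of_symmDiff (m := e (D.min' hne)) ?_ (mem_map_of_mem e hS)
      (by simpa using hT)
    intro x hx
    have hy : OrderDual.ofDual x ∈ S ∆ T := by
      simpa [e, mem_symmDiff, or_comm] using hx
    exact OrderDual.le_toDual.2 (D.min'_le _ (hST ▸ hy))

/-- If `(L, L̄)` is a diametral pair of linear extensions of `B_n`, then each class
`C_{D,I}` with `|D| = d ≥ 2` contributes exactly `2^(d-2)` reversals between `L` and `L̄`. -/
theorem class_contributes_exactly (n : ℕ)
    (L Lbar : Finset (Fin n) → Finset (Fin n) → Prop)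
    (hL : IsLinExt L) (hLbar : IsLinExt Lbar)
    (hdiam : ∀ M₁ M₂ : Finset (Fin n) → Finset (Fin n) → Prop,
      IsLinExt M₁ → IsLinExt M₂ → revCount M₁ M₂ ≤ revCount L Lbar)
    (D I : Finset (Fin n)) (hd : 2 ≤ D.card) (hDI : Disjoint D I) :
    Set.ncard {p : Finset (Fin n) × Finset (Fin n) |
        p.1 ∆ p.2 = D ∧ p.1 ∩ p.2 = I ∧ L p.1 p.2 ∧ Lbar p.2 p.1}
      = 2 ^ (D.card - 2) := by
  obtain ⟨M₁, M₂, hM₁, hM₂, hM⟩ := exists_isLinExt_pow_le_ncard_classReversals (Fin n)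
  have hle : ∀ k ∈ ({k | 2 ≤ #k.1 ∧ Disjoint k.1 k.2} : Finset (Finset (Fin n) × Finset (Fin n))),
      (classReversals L Lbar k.1 k.2).ncard ≤ (classReversals M₁ M₂ k.1 k.2).ncard := by
    intro k hk
    obtain ⟨hk₁, hk₂⟩ := (mem_filter.1 hk).2
    exact (ncard_classReversals_le hL hLbar hk₁ hk₂).trans (hM _ _ hk₁ hk₂)
  have hsum := hdiam M₁ M₂ hM₁ hM₂
  rw [revCount_eq_sum_ncard_classReversals hL hLbar,
    revCount_eq_sum_ncard_classReversals hM₁ hM₂] at hsum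
  have heq := (sum_eq_sum_iff_of_le hle).1 (le_antisymm (sum_le_sum hle) hsum) (D, I)
    (mem_filter.2 ⟨mem_univ _, hd, hDI⟩)
  exact le_antisymm (ncard_classReversals_le hL hLbar hd hDI) ((hM D I hd hDI).trans_eq heq.symm)
end

section
/- Let (L, L̄) be a diametral pair of linear extensions of the Boolean lattice B_n, and let σ be the permutation of [n] recording the order in which the singletons appear in L (i.e. {σ(1)} <_L {σ(2)} <_L … <_L {σ(n)}). Then L = L_σ and L̄ = L_σ̄; that is, the diametral pairs of B_n are exactly the pairs of reverse-lexicographic linear extensions (L_σ, L_σ̄). -/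
open Finset
open scoped symmDiff

section LinExt

open scoped FinsetFamily

variable {α : Type*} {L M : Finset α → Finset α → Prop} {I D A B : Finset α}

lemma IsLinExt.of_subset (hL : IsLinExt L) (h : A ⊆ B) : L A B := hL.2 A B h

lemma IsLinExt.trans (hL : IsLinExt L) {A B C : Finset α} (h : L A B) (h' : L B C) : L A C :=
  hL.1.trans A B C h h'

lemma IsLinExt.antisymm (hL : IsLinExt L) (h : L A B) (h' : L B A) : A = B :=
  hL.1.antisymm A B h h'

lemma IsLinExt.of_not (hL : IsLinExt L) (h : ¬ L A B) : L B A :=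
  (hL.1.total A B).resolve_left h

variable [DecidableEq α]

lemma union_sdiff_ne_union (hID : Disjoint I D) (hD : D.Nonempty) : I ∪ D \ A ≠ I ∪ A := by
  obtain ⟨d, hd⟩ := hD
  have hdI : d ∉ I := fun h => disjoint_left.mp hID h hd
  intro h
  have := congrArg (d ∈ ·) h
  simp [hd, hdI] at this

open Classical in
/-- The sets `A ⊆ D` such that `I ∪ A` lies above its complement in the interval `[I, I ∪ D]`. -/
noncomputable def upperHalf (L : Finset α → Finset α → Prop) (I D : Finset α) :
    Finset (Finset α) :=
  {A ∈ D.powerset | L (I ∪ D \ A) (I ∪ A)}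

/-- The sets `A ⊆ D` such that `I ∪ A` lies above its complement in the interval `[I, I ∪ D]`
with respect to `L`, but not with respect to `M`. -/
noncomputable def reversedHalf (L M : Finset α → Finset α → Prop) (I D : Finset α) :
    Finset (Finset α) :=
  upperHalf L I D \ upperHalf M I D

lemma mem_upperHalf : A ∈ upperHalf L I D ↔ A ⊆ D ∧ L (I ∪ D \ A) (I ∪ A) := by
  simp [upperHalf]

lemma mem_reversedHalf (hM : IsLinExt M) (hID : Disjoint I D)
    (hD : D.Nonempty) : A ∈ reversedHalf L M I D ↔
      A ⊆ D ∧ L (I ∪ D \ A) (I ∪ A) ∧ M (I ∪ A) (I ∪ D \ A) := by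
  simp only [reversedHalf, mem_sdiff, mem_upperHalf]
  constructor
  · rintro ⟨⟨hA, h⟩, h'⟩
    exact ⟨hA, h, hM.of_not fun h'' => h' ⟨hA, h''⟩⟩
  · rintro ⟨hA, h, h'⟩
    exact ⟨⟨hA, h⟩, fun h'' => union_sdiff_ne_union hID hD (hM.antisymm h''.2 h')⟩

lemma mem_upperHalf_of_subset (hL : IsLinExt L) (hA : A ∈ upperHalf L I D) (hAB : A ⊆ B)
    (hB : B ⊆ D) : B ∈ upperHalf L I D := by
  rw [mem_upperHalf] at hA ⊢
  exact ⟨hB, hL.trans (hL.of_subset (union_subset_union_right (sdiff_subset_sdiff subset_rfl hAB)))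
    (hL.trans hA.2 (hL.of_subset (union_subset_union_right hAB)))⟩

lemma two_mul_card_upperHalf (hL : IsLinExt L) (hID : Disjoint I D) (hD : D.Nonempty) :
    2 * #(upperHalf L I D) = 2 ^ #D := by
  classical
  have h₁ := card_filter_add_card_filter_not (s := D.powerset) (fun A => L (I ∪ D \ A) (I ∪ A))
  have h₂ : #{A ∈ D.powerset | ¬ L (I ∪ D \ A) (I ∪ A)} = #(upperHalf L I D) := by
    refine card_nbij' (D \ ·) (D \ ·) ?_ ?_ ?_ ?_
    · intro A hA
      simp only [coe_filter, mem_powerset, Set.mem_ofPred_eq] at hA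
      simp only [mem_coe, mem_upperHalf, sdiff_subset, true_and, Finset.sdiff_sdiff_eq_self hA.1]
      exact hL.of_not hA.2
    · intro A hA
      rw [mem_coe, mem_upperHalf] at hA
      simp only [coe_filter, mem_powerset, Set.mem_ofPred_eq, sdiff_subset, true_and,
        Finset.sdiff_sdiff_eq_self hA.1]
      exact fun h => union_sdiff_ne_union hID hD (hL.antisymm hA.2 h)
    · intro A hA
      simp only [coe_filter, mem_powerset, Set.mem_ofPred_eq] at hA
      exact Finset.sdiff_sdiff_eq_self hA.1
    · intro A hA
      rw [mem_coe, mem_upperHalf] at hA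
      exact Finset.sdiff_sdiff_eq_self hA.1
  rw [card_powerset, h₂] at h₁
  change #(upperHalf L I D) + #(upperHalf L I D) = _ at h₁
  omega

/-- At most half of the complementary pairs of an interval of dimension at least two, and none in
dimension one, are reversed; this is Kleitman's inequality for the two upper halves. -/
lemma four_mul_card_reversedHalf_le (hL : IsLinExt L) (hM : IsLinExt M) (hID : Disjoint I D)
    (hD : D.Nonempty) : 4 * #(reversedHalf L M I D) ≤ 2 ^ #D := by
  have hF := two_mul_card_upperHalf hL hID hD
  have hG := two_mul_card_upperHalf hM hID hD
  have hK := le_card_infs_mul_card_sups (upperHalf L I D) (upperHalf M I D)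
  have hinf : #(upperHalf L I D ⊼ upperHalf M I D) ≤ 2 ^ #D := by
    rw [← card_powerset]
    refine card_le_card fun C hC => ?_
    obtain ⟨A, hA, B, -, rfl⟩ := mem_infs.mp hC
    exact mem_powerset.mpr (inter_subset_left.trans (mem_upperHalf.mp hA).1)
  have hsup : #(upperHalf L I D ⊻ upperHalf M I D) ≤ #(upperHalf L I D ∩ upperHalf M I D) := by
    refine card_le_card fun C hC => ?_
    obtain ⟨A, hA, B, hB, rfl⟩ := mem_sups.mp hC
    have hAB := union_subset (mem_upperHalf.mp hA).1 (mem_upperHalf.mp hB).1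
    exact mem_inter.mpr ⟨mem_upperHalf_of_subset hL hA subset_union_left hAB,
      mem_upperHalf_of_subset hM hB subset_union_right hAB⟩
  have hadd := card_sdiff_add_card_inter (upperHalf L I D) (upperHalf M I D)
  change #(reversedHalf L M I D) + _ = _ at hadd
  have hpos : 0 < 2 ^ #D := by positivity
  have hmul := hK.trans (Nat.mul_le_mul hinf hsup)
  nlinarith

variable [Fintype α]

open Classical in
/-- The pairs `(S, T)` reversed between `L` and `M` with given intersection and symmetric
difference. -/
noncomputable def reversedFiber (L M : Finset α → Finset α → Prop)
    (q : Finset α × Finset α) : Finset (Finset α × Finset α) :=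
  {p ∈ univ.filter (fun p => p.1 ≠ p.2 ∧ L p.1 p.2 ∧ M p.2 p.1) | (p.1 ∩ p.2, p.1 ∆ p.2) = q}

lemma revCount_eq_sum_card_reversedFiber (L M : Finset α → Finset α → Prop) :
    revCount L M = ∑ q, #(reversedFiber L M q) := by
  classical
  rw [revCount, Set.ncard_eq_toFinset_card', Set.toFinset_ofPred]
  exact card_eq_sum_card_fiberwise fun _ _ => mem_coe.mpr (mem_univ _)

lemma mem_reversedFiber {p q : Finset α × Finset α} : p ∈ reversedFiber L M q ↔
    (p.1 ≠ p.2 ∧ L p.1 p.2 ∧ M p.2 p.1) ∧ p.1 ∩ p.2 = q.1 ∧ p.1 ∆ p.2 = q.2 := by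
  simp [reversedFiber, Prod.ext_iff]

lemma disjoint_and_nonempty_of_mem_reversedFiber {p q : Finset α × Finset α}
    (hp : p ∈ reversedFiber L M q) : Disjoint q.1 q.2 ∧ q.2.Nonempty := by
  obtain ⟨⟨hne, -⟩, h₁, h₂⟩ := mem_reversedFiber.mp hp
  rw [← h₁, ← h₂]
  refine ⟨?_, nonempty_iff_ne_empty.mpr fun h => hne (symmDiff_eq_bot.mp h)⟩
  rw [disjoint_left]
  intro x hx
  simp only [mem_inter, mem_symmDiff] at hx ⊢
  tauto

lemma card_reversedFiber (hM : IsLinExt M) (hID : Disjoint I D)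
    (hD : D.Nonempty) : #(reversedFiber L M (I, D)) = #(reversedHalf L M I D) := by
  refine card_nbij' (fun p => p.2 \ I) (fun A => (I ∪ D \ A, I ∪ A)) ?_ ?_ ?_ ?_
  · rintro ⟨S, T⟩ hp
    obtain ⟨⟨hne, h, h'⟩, rfl, rfl⟩ := mem_reversedFiber.mp hp
    have e₁ : S ∩ T ∪ T \ (S ∩ T) = T := by grind
    have e₂ : S ∩ T ∪ S ∆ T \ (T \ (S ∩ T)) = S := by ext; simp [mem_symmDiff]; tauto
    rw [mem_coe, mem_reversedHalf hM hID hD]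
    simp only [e₁, e₂]
    exact ⟨fun x hx => by simp [mem_symmDiff] at hx ⊢; tauto, h, h'⟩
  · intro A hA
    rw [mem_coe, mem_reversedHalf hM hID hD] at hA
    obtain ⟨hA, h, h'⟩ := hA
    rw [mem_coe, mem_reversedFiber]
    refine ⟨⟨union_sdiff_ne_union hID hD, h, h'⟩, ?_, ?_⟩
    · grind
    · ext x
      have := @hA x
      have : x ∈ I → x ∉ D := fun h => disjoint_left.mp hID h
      simp [mem_symmDiff]
      tauto
  · rintro ⟨S, T⟩ hp
    obtain ⟨⟨hne, h, h'⟩, rfl, rfl⟩ := mem_reversedFiber.mp hp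
    have e₁ : S ∩ T ∪ T \ (S ∩ T) = T := by grind
    have e₂ : S ∩ T ∪ S ∆ T \ (T \ (S ∩ T)) = S := by ext; simp [mem_symmDiff]; tauto
    simp only [e₁, e₂]
  · intro A hA
    rw [mem_coe, mem_reversedHalf hM hID hD] at hA
    exact union_sdiff_cancel_left (hID.mono_right hA.1)

end LinExt

section RevLex

variable {n : ℕ} {σ : Equiv.Perm (Fin n)} {I D S T : Finset (Fin n)}

lemma revPermOf_symm_le_iff (x y : Fin n) :
    (revPermOf σ).symm x ≤ (revPermOf σ).symm y ↔ σ.symm y ≤ σ.symm x := by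
  simp [revPermOf]

lemma revPermOf_symm_lt_iff (x y : Fin n) :
    (revPermOf σ).symm x < (revPermOf σ).symm y ↔ σ.symm y < σ.symm x := by
  simp [revPermOf]

lemma sigmaRevLex_or_sigmaRevLexLT (σ : Equiv.Perm (Fin n)) (S T : Finset (Fin n)) :
    SigmaRevLex σ S T ∨ SigmaRevLexLT σ T S := by
  by_cases hST : S = T
  · exact .inl (.inl hST)
  have hne : (S ∆ T).Nonempty := nonempty_iff_ne_empty.mpr fun h => hST (symmDiff_eq_bot.mp h)
  obtain ⟨m, hm, hmax⟩ := exists_max_image _ σ.symm hne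
  rcases mem_symmDiff.mp hm with h | h
  · exact .inr ⟨m, mem_sdiff.mpr h, by rwa [symmDiff_comm]⟩
  · exact .inl (.inr ⟨m, mem_sdiff.mpr h, hmax⟩)

lemma SigmaRevLexLT.trans {U : Finset (Fin n)} (h : SigmaRevLexLT σ S T)
    (h' : SigmaRevLexLT σ T U) : SigmaRevLexLT σ S U := by
  obtain ⟨a, ha, hmaxa⟩ := h
  obtain ⟨b, hb, hmaxb⟩ := h'
  rw [mem_sdiff] at ha hb
  have hab : a ≠ b := by rintro rfl; exact hb.2 ha.1
  have hab' : σ.symm a ≠ σ.symm b := by simpa using hab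
  have hsub : ∀ x ∈ S ∆ U, x ∈ S ∆ T ∨ x ∈ T ∆ U := by
    intro x hx; simp only [mem_symmDiff] at hx ⊢; tauto
  rcases hab'.lt_or_gt with hlt | hlt
  · refine ⟨b, mem_sdiff.mpr ⟨hb.1, fun hbS => ?_⟩, fun x hx => ?_⟩
    · exact (hmaxa b (mem_symmDiff.mpr (.inl ⟨hbS, hb.2⟩))).not_gt hlt
    · rcases hsub x hx with h | h
      · exact (hmaxa x h).trans hlt.le
      · exact hmaxb x h
  · refine ⟨a, mem_sdiff.mpr ⟨by_contra fun haU => ?_, ha.2⟩, fun x hx => ?_⟩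
    · exact (hmaxb a (mem_symmDiff.mpr (.inl ⟨ha.1, haU⟩))).not_gt hlt
    · rcases hsub x hx with h | h
      · exact hmaxa x h
      · exact (hmaxb x h).trans hlt.le

lemma not_sigmaRevLexLT_self (S : Finset (Fin n)) : ¬ SigmaRevLexLT σ S S := by
  rintro ⟨m, hm, -⟩
  simp at hm

lemma isLinExt_sigmaRevLex (σ : Equiv.Perm (Fin n)) : IsLinExt (SigmaRevLex σ) := by
  refine ⟨{ refl := fun S => .inl rfl, trans := ?_, antisymm := ?_, total := ?_ }, ?_⟩
  · rintro S T U (rfl | h) (rfl | h')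
    · exact .inl rfl
    · exact .inr h'
    · exact .inr h
    · exact .inr (h.trans h')
  · rintro S T (rfl | h) (h' | h')
    · rfl
    · rfl
    · exact h'.symm
    · exact (not_sigmaRevLexLT_self S (h.trans h')).elim
  · exact fun S T => (sigmaRevLex_or_sigmaRevLexLT σ S T).imp_right .inr
  · intro S T hST
    refine (sigmaRevLex_or_sigmaRevLexLT σ S T).resolve_right ?_
    rintro ⟨m, hm, -⟩
    exact (mem_sdiff.mp hm).2 (hST (mem_sdiff.mp hm).1)

lemma card_Icc_singleton_erase {α : Type*} [DecidableEq α] {D : Finset α} {a c : α} (ha : a ∈ D)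
    (hc : c ∈ D) (hac : a ≠ c) : #(Icc {c} (D.erase a)) = 2 ^ (#D - 2) := by
  rw [card_Icc_finset (by simpa using ⟨hac.symm, hc⟩), card_erase_of_mem ha, card_singleton,
    Nat.sub_sub]

lemma two_pow_le_card_reversedHalf_sigmaRevLex (σ : Equiv.Perm (Fin n)) (hID : Disjoint I D)
    (hD : 2 ≤ #D) :
    2 ^ (#D - 2) ≤ #(reversedHalf (SigmaRevLex σ) (SigmaRevLex (revPermOf σ)) I D) := by
  have hD' : D.Nonempty := card_pos.mp (by omega)
  obtain ⟨c, hc, hcmax⟩ := exists_max_image D σ.symm hD'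
  obtain ⟨a, ha, hamin⟩ := exists_min_image D σ.symm hD'
  have hac : a ≠ c := by
    rintro rfl
    obtain ⟨x, hx, y, hy, hxy⟩ := one_lt_card.mp hD
    refine hxy (σ.symm.injective ?_)
    exact ((hcmax x hx).antisymm (hamin x hx)).trans ((hcmax y hy).antisymm (hamin y hy)).symm
  rw [← card_Icc_singleton_erase ha hc hac]
  refine card_le_card fun A hA => ?_
  simp only [mem_Icc, singleton_subset_iff] at hA
  obtain ⟨hcA, hAD⟩ := hA
  have haA : a ∉ A := fun h => by simpa using hAD h
  have hAD := hAD.trans (erase_subset a D)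
  have haI : a ∉ I := fun h => disjoint_left.mp hID h ha
  have hcI : c ∉ I := fun h => disjoint_left.mp hID h hc
  rw [mem_reversedHalf (isLinExt_sigmaRevLex _) hID hD']
  refine ⟨hAD, .inr ⟨c, by simp [hcA, hcI], fun x hx => hcmax x ?_⟩,
    .inr ⟨a, by simp [ha, haA, haI], fun x hx => (revPermOf_symm_le_iff _ _).mpr (hamin x ?_)⟩⟩
  all_goals
    have := @hAD x
    simp only [mem_symmDiff, mem_union, mem_sdiff] at hx
    tauto

end RevLex

section Diametral

variable {n : ℕ} {L M : Finset (Fin n) → Finset (Fin n) → Prop} {σ : Equiv.Perm (Fin n)}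

lemma two_pow_le_card_reversedHalf_of_diametral (hL : IsLinExt L) (hM : IsLinExt M)
    (hdiam : ∀ M₁ M₂ : Finset (Fin n) → Finset (Fin n) → Prop,
      IsLinExt M₁ → IsLinExt M₂ → revCount M₁ M₂ ≤ revCount L M)
    {I D : Finset (Fin n)} (hID : Disjoint I D) (hD : 2 ≤ #D) :
    2 ^ (#D - 2) ≤ #(reversedHalf L M I D) := by
  have hR := isLinExt_sigmaRevLex (Equiv.refl (Fin n))
  have hR' := isLinExt_sigmaRevLex (revPermOf (Equiv.refl (Fin n)))
  have hle : ∀ q ∈ (univ : Finset (Finset (Fin n) × Finset (Fin n))), #(reversedFiber L M q) ≤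
      #(reversedFiber (SigmaRevLex (Equiv.refl (Fin n)))
        (SigmaRevLex (revPermOf (Equiv.refl (Fin n)))) q) := by
    rintro ⟨I, D⟩ -
    rcases (reversedFiber L M (I, D)).eq_empty_or_nonempty with h | ⟨p, hp⟩
    · simp [h]
    obtain ⟨hID, hD⟩ := disjoint_and_nonempty_of_mem_reversedFiber hp
    dsimp only at hID hD
    rw [card_reversedFiber hM hID hD, card_reversedFiber hR' hID hD]
    have h₁ := four_mul_card_reversedHalf_le hL hM hID hD
    rcases (Nat.succ_le_of_lt hD.card_pos).eq_or_lt' with h | h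
    · rw [h] at h₁
      omega
    · have h₂ := two_pow_le_card_reversedHalf_sigmaRevLex (Equiv.refl (Fin n)) hID h
      obtain ⟨k, hk⟩ := Nat.exists_eq_add_of_le' h
      rw [hk] at h₁ h₂
      simp only [Nat.succ_eq_add_one, Nat.reduceAdd, Nat.add_sub_cancel, pow_add] at h₁ h₂
      omega
  have hsum := hdiam _ _ hR hR'
  rw [revCount_eq_sum_card_reversedFiber, revCount_eq_sum_card_reversedFiber] at hsum
  have heq := (sum_eq_sum_iff_of_le hle).mp ((sum_le_sum hle).antisymm hsum) (I, D) (mem_univ _)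
  have hD' : D.Nonempty := card_pos.mp (by omega)
  rw [card_reversedFiber hM hID hD', card_reversedFiber hR' hID hD'] at heq
  exact heq ▸ two_pow_le_card_reversedHalf_sigmaRevLex _ hID hD

/-- If every interval of dimension at least two contains as many reversed complementary pairs as
possible, then pairs of sets covering a common set are reversed. -/
lemma reversed_insert_insert (hL : IsLinExt L) (hM : IsLinExt M)
    (hcard : ∀ I D : Finset (Fin n), Disjoint I D → 2 ≤ #D →
      2 ^ (#D - 2) ≤ #(reversedHalf L M I D))
    {I : Finset (Fin n)} {a b : Fin n} (haI : a ∉ I) (hbI : b ∉ I) (hab : a ≠ b) :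
    L (insert a I) (insert b I) ↔ M (insert b I) (insert a I) := by
  have hID : Disjoint I {a, b} := by simp [haI, hbI]
  have hD : ({a, b} : Finset (Fin n)).Nonempty := insert_nonempty _ _
  have h := hcard I {a, b} hID (by rw [card_pair hab])
  obtain ⟨A, hA⟩ := card_pos.mp (lt_of_lt_of_le (by positivity) h)
  rw [mem_reversedHalf hM hID hD] at hA
  obtain ⟨hA, h₁, h₂⟩ := hA
  have hne : I ∪ {a, b} \ A ≠ I ∪ A := union_sdiff_ne_union hID hD
  have hne' : insert a I ≠ insert b I := by
    intro h
    have := h ▸ mem_insert_self a I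
    simp [haI, hab] at this
  rcases (show A = ∅ ∨ A = {a} ∨ A = {b} ∨ A = {a, b} by
    rw [← coe_subset, coe_pair, Set.subset_pair_iff_eq] at hA
    simp only [← coe_inj, coe_empty, coe_singleton, coe_pair]
    exact hA) with rfl | rfl | rfl | rfl
  · exact (hne (hL.antisymm h₁ (hL.of_subset (by grind)))).elim
  · have e : ({a, b} : Finset (Fin n)) \ {a} = {b} := by grind
    rw [e, union_singleton, union_singleton] at h₁ h₂
    exact ⟨fun h => (hne' (hL.antisymm h h₁)).elim, fun h => (hne' (hM.antisymm h₂ h)).elim⟩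
  · have e : ({a, b} : Finset (Fin n)) \ {b} = {a} := by grind
    rw [e, union_singleton, union_singleton] at h₁ h₂
    exact ⟨fun _ => h₂, fun _ => h₁⟩
  · exact (hne (hM.antisymm (hM.of_subset (by grind)) h₂)).elim

/-- If the order of all complementary pairs in `[I, I ∪ D]` but the extremal ones is dictated by
the element `c` for `L` and by the element `a` for `M`, so is the order of the extremal ones. -/
lemma extremal_pairs_of_card (hL : IsLinExt L) (hM : IsLinExt M) {I D : Finset (Fin n)}
    {a c : Fin n} (hID : Disjoint I D) (ha : a ∈ D) (hc : c ∈ D) (hD : 3 ≤ #D)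
    (hac : a ≠ c) (hcard : 2 ^ (#D - 2) ≤ #(reversedHalf L M I D))
    (h₁ : ∀ A ⊂ D.erase c, L (I ∪ A) (I ∪ {c})) (h₂ : ∀ A ⊂ D.erase a, M (I ∪ A) (I ∪ {a})) :
    L (I ∪ D.erase c) (I ∪ {c}) ∧ M (I ∪ D.erase a) (I ∪ {a}) := by
  have hne : D.Nonempty := ⟨a, ha⟩
  have hlt : ∀ {x y : Fin n}, x ∈ D → y ∈ D → x ≠ y → {x} ⊂ D.erase y := by
    intro x y hx hy hxy
    refine (singleton_subset_iff.mpr (mem_erase.mpr ⟨hxy, hx⟩)).ssubset_of_ne fun h => ?_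
    have := congrArg card h
    rw [card_singleton, card_erase_of_mem hy] at this
    omega
  -- a set on the wrong side of its complement would contradict one of the hypotheses
  have key : ∀ {K : Finset (Fin n) → Finset (Fin n) → Prop} {e : Fin n} {A : Finset (Fin n)},
      IsLinExt K → e ∈ D → (∀ A ⊂ D.erase e, K (I ∪ A) (I ∪ {e})) → A ⊂ D.erase e →
      K (I ∪ A) (I ∪ D \ A) := by
    intro K e A hK he h hA
    refine hK.trans (h A hA) (hK.of_subset (union_subset_union_right ?_))
    exact singleton_subset_iff.mpr (mem_sdiff.mpr ⟨he, fun h => by simpa using hA.1 h⟩)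
  have hsub : reversedHalf L M I D ⊆ Icc {c} (D.erase a) := by
    intro A hA
    rw [mem_reversedHalf hM hID hne] at hA
    obtain ⟨hA, hLA, hMA⟩ := hA
    have hneA : I ∪ D \ A ≠ I ∪ A := union_sdiff_ne_union hID hne
    simp only [mem_Icc, singleton_subset_iff, subset_erase]
    refine ⟨by_contra fun hcA => ?_, hA, fun haA => ?_⟩
    · rcases (subset_erase.mpr ⟨hA, hcA⟩).eq_or_ssubset with rfl | h
      · rw [sdiff_erase_self hc] at hMA hneA
        refine hneA (hM.antisymm (hM.trans (h₂ _ (hlt hc ha hac.symm)) (hM.of_subset ?_)) hMA)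
        exact union_subset_union_right (hlt ha hc hac).1
      · exact hneA (hL.antisymm hLA (key hL hc h₁ h))
    · rcases (show D \ A ⊆ D.erase a from fun x hx => by grind).eq_or_ssubset with h | h
      · rw [h] at hLA hneA
        obtain rfl : A = {a} := by rw [← sdiff_erase_self ha, ← h, Finset.sdiff_sdiff_eq_self hA]
        refine hneA (hL.antisymm hLA (hL.trans (h₁ _ (hlt ha hc hac)) (hL.of_subset ?_)))
        exact union_subset_union_right (hlt hc ha hac.symm).1
      · have := key hM ha h₂ h
        rw [Finset.sdiff_sdiff_eq_self hA] at this
        exact hneA (hM.antisymm this hMA)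
  have heq := eq_of_subset_of_card_le hsub (by rwa [card_Icc_singleton_erase ha hc hac])
  have hmem : ∀ A, {c} ⊆ A → A ⊆ D.erase a → L (I ∪ D \ A) (I ∪ A) ∧ M (I ∪ A) (I ∪ D \ A) :=
    fun A h h' =>
      ((mem_reversedHalf hM hID hne).mp (heq ▸ mem_Icc.mpr ⟨h, h'⟩ : A ∈ _)).2
  have hca : {c} ⊆ D.erase a := (hlt hc ha hac.symm).1
  refine ⟨?_, ?_⟩
  · simpa [sdiff_singleton_eq_erase] using (hmem {c} subset_rfl hca).1
  · simpa [sdiff_erase ha] using (hmem (D.erase a) hca subset_rfl).2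

/-- Above `I`, the order of the covers of `I` determines the order of a cover of `I` and a join of
covers which all come before it. -/
lemma union_singleton_of_forall_lt (hL : IsLinExt L) (hM : IsLinExt M)
    (hcard : ∀ I D : Finset (Fin n), Disjoint I D → 2 ≤ #D →
      2 ^ (#D - 2) ≤ #(reversedHalf L M I D))
    {I : Finset (Fin n)}
    (hI : ∀ a ∉ I, ∀ b ∉ I, σ.symm a < σ.symm b →
      L (I ∪ {a}) (I ∪ {b}) ∧ M (I ∪ {b}) (I ∪ {a}))
    {A : Finset (Fin n)} (hA : Disjoint I A) {c : Fin n} (hc : c ∉ I) :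
    ((∀ x ∈ A, σ.symm x < σ.symm c) → L (I ∪ A) (I ∪ {c})) ∧
      ((∀ x ∈ A, σ.symm c < σ.symm x) → M (I ∪ A) (I ∪ {c})) := by
  induction hk : #A using Nat.strong_induction_on generalizing A c with
  | _ k ih =>
  subst hk
  rcases A.eq_empty_or_nonempty with rfl | hne
  · exact ⟨fun _ => hL.of_subset (by simp), fun _ => hM.of_subset (by simp)⟩
  rcases (Nat.succ_le_of_lt hne.card_pos).eq_or_lt' with h1 | h2
  · obtain ⟨a, rfl⟩ := card_eq_one.mp h1
    have ha : a ∉ I := by simpa using hA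
    exact ⟨fun h => (hI a ha c hc (by simpa using h)).1,
      fun h => (hI c hc a ha (by simpa using h)).2⟩
  have core : ∀ {D : Finset (Fin n)} {a e : Fin n}, Disjoint I D → #D = #A + 1 → a ∈ D → e ∈ D →
      a ≠ e → (∀ x ∈ D, x ≠ a → σ.symm a < σ.symm x) → (∀ x ∈ D, x ≠ e → σ.symm x < σ.symm e) →
      L (I ∪ D.erase e) (I ∪ {e}) ∧ M (I ∪ D.erase a) (I ∪ {a}) := by
    intro D a e hID hDA ha he hae hmin hmax
    have hsmall : ∀ {B : Finset (Fin n)} {y : Fin n}, y ∈ D → B ⊂ D.erase y →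
        Disjoint I B ∧ #B < #A := by
      intro B y hy hB
      have := card_lt_card hB
      rw [card_erase_of_mem hy] at this
      exact ⟨hID.mono_right (hB.1.trans (erase_subset _ _)), by omega⟩
    refine extremal_pairs_of_card hL hM hID ha he (by omega) hae (hcard I D hID (by omega)) ?_ ?_
    · intro B hB
      obtain ⟨hIB, hBA⟩ := hsmall he hB
      refine (ih _ hBA hIB (fun h => disjoint_left.mp hID h he) rfl).1 fun x hx => ?_
      obtain ⟨hxe, hxD⟩ := mem_erase.mp (hB.1 hx)
      exact hmax x hxD hxe
    · intro B hB
      obtain ⟨hIB, hBA⟩ := hsmall ha hB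
      refine (ih _ hBA hIB (fun h => disjoint_left.mp hID h ha) rfl).2 fun x hx => ?_
      obtain ⟨hxa, hxD⟩ := mem_erase.mp (hB.1 hx)
      exact hmin x hxD hxa
  have hID : Disjoint I (insert c A) := by simp [hc, hA]
  refine ⟨fun h => ?_, fun h => ?_⟩
  · have hcA : c ∉ A := fun hcA => (h c hcA).false
    obtain ⟨a, ha, hmin⟩ := exists_min_image A σ.symm hne
    have hlt : ∀ x ∈ A, x ≠ a → σ.symm a < σ.symm x := fun x hx hxa =>
      (hmin x hx).lt_of_ne fun h => hxa (σ.symm.injective h).symm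
    have := (core (a := a) (e := c) hID (card_insert_of_notMem hcA) (mem_insert_of_mem ha)
      (mem_insert_self _ _) (by rintro rfl; exact hcA ha)
      (by simpa [h a ha] using hlt)
      (by simpa using fun x hx _ => h x hx)).1
    rwa [erase_insert hcA] at this
  · have hcA : c ∉ A := fun hcA => (h c hcA).false
    obtain ⟨a, ha, hmax⟩ := exists_max_image A σ.symm hne
    have hlt : ∀ x ∈ A, x ≠ a → σ.symm x < σ.symm a := fun x hx hxa =>
      (hmax x hx).lt_of_ne fun h => hxa (σ.symm.injective h)
    have := (core (a := c) (e := a) hID (card_insert_of_notMem hcA) (mem_insert_self _ _)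
      (mem_insert_of_mem ha) (by rintro rfl; exact hcA ha) (by simpa using fun x hx _ => h x hx)
      (by simpa [h a ha] using hlt)).2
    rwa [erase_insert hcA] at this

/-- The covers of every set appear in the order of the singletons. -/
lemma union_singleton_union_singleton (hL : IsLinExt L) (hM : IsLinExt M)
    (hcard : ∀ I D : Finset (Fin n), Disjoint I D → 2 ≤ #D →
      2 ^ (#D - 2) ≤ #(reversedHalf L M I D))
    (hσ : ∀ a b, σ.symm a < σ.symm b → L {a} {b}) (I : Finset (Fin n)) :
    ∀ a ∉ I, ∀ b ∉ I, σ.symm a < σ.symm b →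
      L (I ∪ {a}) (I ∪ {b}) ∧ M (I ∪ {b}) (I ∪ {a}) := by
  have hrev : ∀ {I : Finset (Fin n)} {a b : Fin n}, a ∉ I → b ∉ I → σ.symm a < σ.symm b →
      (L (I ∪ {a}) (I ∪ {b}) ↔ M (I ∪ {b}) (I ∪ {a})) := by
    intro I a b ha hb hab
    simpa only [union_singleton] using
      reversed_insert_insert hL hM hcard ha hb (by rintro rfl; exact hab.false)
  induction I using Finset.induction_on with
  | empty =>
    intro a ha b hb hab
    have h : L (∅ ∪ {a}) (∅ ∪ {b}) := by simpa using hσ a b hab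
    exact ⟨h, (hrev ha hb hab).mp h⟩
  | insert x I hx ih =>
    intro a ha b hb hab
    have hax : a ≠ x := by rintro rfl; simp at ha
    have hbx : b ≠ x := by rintro rfl; simp at hb
    have haI : a ∉ I := fun h => ha (mem_insert_of_mem h)
    have hbI : b ∉ I := fun h => hb (mem_insert_of_mem h)
    have hab' := hrev ha hb hab
    have hsub : ∀ y, I ∪ {y} ⊆ insert x I ∪ {y} := fun y =>
      union_subset_union_left (subset_insert _ _)
    have heq : ∀ y, insert x I ∪ {y} = I ∪ {x, y} := fun y => by grind
    have key := @union_singleton_of_forall_lt n L M σ hL hM hcard I ih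
    rcases lt_or_gt_of_ne (fun h => hbx (σ.symm.injective h) : σ.symm b ≠ σ.symm x) with h | h
    · have h' : M (insert x I ∪ {b}) (insert x I ∪ {a}) := by
        refine hM.trans ?_ (hM.of_subset (hsub a))
        rw [heq]
        exact (key (by simp [hx, hbI]) haI).2 (by simpa using ⟨hab.trans h, hab⟩)
      exact ⟨hab'.mpr h', h'⟩
    · have h' : L (insert x I ∪ {a}) (insert x I ∪ {b}) := by
        refine hL.trans ?_ (hL.of_subset (hsub b))
        rw [heq]
        exact (key (by simp [hx, haI]) hbI).1 (by simpa using ⟨h, hab⟩)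
      exact ⟨h', hab'.mp h'⟩

/-- A linear extension in which a set of `σ`-smaller elements never beats a single element, above
any common set, is the `σ`-revlex order. -/
lemma eq_sigmaRevLex (hL : IsLinExt L)
    (h : ∀ I A : Finset (Fin n), Disjoint I A → ∀ c ∉ I, (∀ x ∈ A, σ.symm x < σ.symm c) →
      L (I ∪ A) (I ∪ {c})) : L = SigmaRevLex σ := by
  have hle : ∀ {S T}, SigmaRevLexLT σ S T → L S T := by
    rintro S T ⟨m, hm, hmax⟩
    rw [mem_sdiff] at hm
    have hS : S ∩ T ∪ S \ T = S := by grind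
    rw [← hS]
    refine hL.trans (h _ _ ?_ m (by simp [hm]) fun x hx => ?_) (hL.of_subset (B := T) ?_)
    · exact disjoint_left.mpr (by simp; tauto)
    · rw [mem_sdiff] at hx
      refine (hmax x (mem_symmDiff.mpr (.inl hx))).lt_of_ne fun he => ?_
      exact hx.2 (σ.symm.injective he ▸ hm.1)
    · exact union_subset inter_subset_right (singleton_subset_iff.mpr hm.1)
  ext S T
  constructor
  · intro hST
    refine (sigmaRevLex_or_sigmaRevLexLT σ S T).elim id fun h' => ?_
    exact .inl (hL.antisymm hST (hle h'))
  · rintro (rfl | h')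
    · exact hL.of_subset subset_rfl
    · exact hle h'

end Diametral

/-- If `(L, L̄)` is a diametral pair of linear extensions of `B_n` and σ is the
permutation recording the order of the singletons in `L`, then `L = L_σ` and `L̄ = L_σ̄`. -/
theorem diametral_pairs_unique (n : ℕ)
    (L Lbar : Finset (Fin n) → Finset (Fin n) → Prop)
    (hL : IsLinExt L) (hLbar : IsLinExt Lbar)
    (hdiam : ∀ M₁ M₂ : Finset (Fin n) → Finset (Fin n) → Prop,
      IsLinExt M₁ → IsLinExt M₂ → revCount M₁ M₂ ≤ revCount L Lbar)
    (σ : Equiv.Perm (Fin n))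
    (hσ : ∀ i j : Fin n, L {i} {j} ↔ σ.symm i ≤ σ.symm j) :
    L = SigmaRevLex σ ∧ Lbar = SigmaRevLex (revPermOf σ) := by
  have hcard := fun I D hID hD =>
    two_pow_le_card_reversedHalf_of_diametral hL hLbar hdiam (I := I) (D := D) hID hD
  have hI := union_singleton_union_singleton hL hLbar hcard fun a b h => (hσ a b).mpr h.le
  refine ⟨eq_sigmaRevLex hL fun I A hIA c hc => ?_, eq_sigmaRevLex hLbar fun I A hIA c hc => ?_⟩
  · exact (union_singleton_of_forall_lt hL hLbar hcard (hI I) hIA hc).1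
  · simp only [revPermOf_symm_lt_iff]
    exact (union_singleton_of_forall_lt hL hLbar hcard (hI I) hIA hc).2
end
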